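/- Let A be the Artin group on a connected presentation graph containing a triangle with edge labels (2,2,m) for some m ≥ 3. Then A contains a subgroup isomorphic to ℤ³ and also contains a non-abelian free subgroup. Consequently A is not weakly commensurable with the fundamental group of any compact irreducible 3-manifold. -/

import Mathlib

/-- The alternating word `(x, y)_m = x y x y ⋯` with `m` letters. -/
def artinWord {V : Type} (x y : V) : ℕ → FreeGroup V
  | 0 => 1
  | n + 1 => FreeGroup.of x * artinWord y x n

/-- The Artin group of a labeled graph, encoded by a symmetric label matrix
`M : V → V → ℕ`: generators the vertices, and for each pair with `2 ≤ M x y`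
(an edge labeled `M x y`) the relation `(x,y)_{M x y} = (y,x)_{M x y}`;
pairs with `M x y ∈ {0, 1}` (label `∞`) give no relation. -/
abbrev ArtinGroup (V : Type) (M : V → V → ℕ) : Type :=
  PresentedGroup {r : FreeGroup V | ∃ x y : V, 2 ≤ M x y ∧
    r = artinWord x y (M x y) * (artinWord y x (M x y))⁻¹}


namespace ArtinAux

/-- Alternating product in a monoid. -/
def altW {G : Type*} [Monoid G] (a b : G) : ℕ → G
  | 0 => 1
  | n + 1 => a * altW b a n

lemma map_altW {G H : Type*} [Monoid G] [Monoid H] (f : G →* H) (n : ℕ) :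
    ∀ a b : G, f (altW a b n) = altW (f a) (f b) n := by
  induction n with
  | zero => intro a b; simp [altW]
  | succ n ih => intro a b; simp [altW, ih]

lemma artinWord_eq {V : Type} (n : ℕ) : ∀ x y : V,
    artinWord x y n = altW (FreeGroup.of x) (FreeGroup.of y) n := by
  induction n with
  | zero => intro a b; simp [altW, artinWord]
  | succ n ih => intro a b; simp [altW, artinWord, ih]

lemma altW_mem {G : Type*} [Monoid G] (S : Submonoid G) (n : ℕ) :
    ∀ a b : G, a ∈ S → b ∈ S → altW a b n ∈ S := by
  induction n with
  | zero => intro a b _ _; exact S.one_mem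
  | succ n ih => intro a b ha hb; exact S.mul_mem ha (ih b a hb ha)

lemma altW_succ' {G : Type*} [Monoid G] (n : ℕ) :
    ∀ a b : G, altW a b (n + 1) = altW a b n * (if Even n then a else b) := by
  induction n with
  | zero => intro a b; simp [altW]
  | succ n ih =>
    intro a b
    rw [altW, ih b a, altW, mul_assoc]
    by_cases h : Even n <;> simp [h, Nat.even_add_one]

lemma delta_comm {G : Type*} [Monoid G] (a b : G) (m : ℕ) (h : altW a b m = altW b a m) :
    Commute a (altW a b m * altW a b m) := by
  have e1 : a * altW a b m = altW a b m * (if Even m then a else b) := by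
    conv_lhs => rw [h]
    exact altW_succ' m a b
  have e2 : b * altW a b m = altW a b m * (if Even m then b else a) := by
    conv_rhs => rw [h]
    exact altW_succ' m b a
  unfold Commute SemiconjBy
  by_cases hm : Even m
  · simp only [hm, if_true] at e1
    rw [← mul_assoc, e1, mul_assoc, e1, mul_assoc]
  · simp only [hm, if_false] at e1 e2
    rw [← mul_assoc, e1, mul_assoc, e2, mul_assoc]

/-- Structure constants of the representation (parameter `q = 100`). -/
noncomputable def bil {V : Type} (M : V → V → ℕ) (s t : V) : ℝ :=
  open Classical in if s = t then 101 else -(20 * Real.cos (Real.pi / M s t))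

lemma bil_self {V : Type} (M : V → V → ℕ) (s : V) : bil M s s = 101 := by simp [bil]

lemma bil_ne {V : Type} (M : V → V → ℕ) {s t : V} (h : s ≠ t) :
    bil M s t = -(20 * Real.cos (Real.pi / M s t)) := by simp [bil, h]

/-- The action of a generator. -/
noncomputable def sig {V : Type} (M : V → V → ℕ) (s : V) : Equiv.Perm (V → ℝ) where
  toFun f := fun t => f t - f s * bil M s t
  invFun f := fun t => f t - f s / 100 * bil M s t
  left_inv f := by
    funext t
    simp only [bil_self]; ring
  right_inv f := by
    funext t
    simp only [bil_self]; ring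

lemma sig_apply {V : Type} (M : V → V → ℕ) (s t : V) (f : V → ℝ) :
    sig M s f t = f t - f s * bil M s t := rfl

/-- The linear recurrence. -/
noncomputable def rec2 (k a b : ℝ) : ℕ → ℝ
  | 0 => a
  | 1 => b
  | n + 2 => -100 * rec2 k a b n + k * rec2 k a b (n + 1)

lemma rec2_formula (θ a b : ℝ) (n : ℕ) :
    10 * Real.sin θ * rec2 (20 * Real.cos θ) a b n =
      10 ^ n * (b * Real.sin (n * θ) - 10 * a * Real.sin (n * θ - θ)) ∧
    10 * Real.sin θ * rec2 (20 * Real.cos θ) a b (n + 1) =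
      10 ^ (n + 1) * (b * Real.sin (n * θ + θ) - 10 * a * Real.sin (n * θ)) := by
  induction n with
  | zero => simp [rec2]; constructor <;> ring
  | succ n ih =>
    obtain ⟨h1, h2⟩ := ih
    constructor
    · rw [h2]; push_cast
      rw [show ((n : ℝ) + 1) * θ = n * θ + θ by ring, show (n : ℝ) * θ + θ - θ = n * θ by ring]
    · rw [rec2]
      have hs := Real.sin_sq_add_cos_sq θ
      push_cast
      rw [show ((n : ℝ) + 1) * θ = n * θ + θ by ring]
      have : 10 * Real.sin θ * (-100 * rec2 (20 * Real.cos θ) a b n +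
          20 * Real.cos θ * rec2 (20 * Real.cos θ) a b (n + 1)) =
          -100 * (10 * Real.sin θ * rec2 (20 * Real.cos θ) a b n) +
          20 * Real.cos θ * (10 * Real.sin θ * rec2 (20 * Real.cos θ) a b (n + 1)) := by ring
      rw [this, h1, h2, Real.sin_add (n * θ + θ), Real.sin_sub, Real.sin_add, Real.cos_add,
        pow_succ, pow_succ]
      linear_combination (100 * 10 ^ n * b * Real.sin (n * θ)) * hs

lemma rec2_period (m : ℕ) (hm : 2 ≤ m) (a b : ℝ) :
    rec2 (20 * Real.cos (Real.pi / m)) a b m = -10 ^ m * a ∧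
    rec2 (20 * Real.cos (Real.pi / m)) a b (m + 1) = -10 ^ m * b := by
  have hm' : (2 : ℝ) ≤ m := by exact_mod_cast hm
  have hs : 0 < Real.sin (Real.pi / m) := by
    apply Real.sin_pos_of_pos_of_lt_pi
    · have := Real.pi_pos
      positivity
    · rw [div_lt_iff₀ (by linarith)]
      nlinarith [Real.pi_pos]
  obtain ⟨h1, h2⟩ := rec2_formula (Real.pi / m) a b m
  have e : (m : ℝ) * (Real.pi / m) = Real.pi := by field_simp
  rw [e, Real.sin_pi, Real.sin_pi_sub] at h1
  rw [e, Real.sin_pi, add_comm Real.pi, Real.sin_add_pi] at h2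
  have hs10 : (10 * Real.sin (Real.pi / m)) ≠ 0 := by positivity
  constructor
  · apply mul_left_cancel₀ hs10; rw [h1]; ring
  · apply mul_left_cancel₀ hs10; rw [h2, pow_succ]; ring

/-- Vectors in the affine plane through `v` spanned by two roots. -/
noncomputable def st {V : Type} (M : V → V → ℕ) (v : V → ℝ) (s t : V) (p u : ℝ) : V → ℝ :=
  fun w => v w + p * bil M s w + u * bil M t w

lemma st_swap {V : Type} (M : V → V → ℕ) (v : V → ℝ) (s t : V) (p u : ℝ) :
    st M v s t p u = st M v t s u p := by
  funext w; simp only [st]; ring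

lemma sig_st {V : Type} (M : V → V → ℕ) (v : V → ℝ) (s t : V) (k p u : ℝ)
    (hv : v s = 0) (hk : bil M t s = -k) :
    sig M s (st M v s t p u) = st M v s t (-100 * p + k * u) u := by
  funext w
  simp only [sig_apply, st, hv, hk, bil_self]; ring

lemma word_st {V : Type} (M : V → V → ℕ) (v : V → ℝ) (k : ℝ) (n : ℕ) :
    ∀ (s t : V) (p u : ℝ), v s = 0 → v t = 0 → bil M t s = -k → bil M s t = -k →
    altW (sig M s) (sig M t) n (st M v s t p u) =
      if Even n then st M v s t (rec2 k u p (n + 1)) (rec2 k u p n)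
      else st M v s t (rec2 k p u (n + 1)) (rec2 k p u n) := by
  induction n with
  | zero => intro s t p u _ _ _ _; simp [altW, rec2]
  | succ n ih =>
    intro s t p u hs ht h1 h2
    rw [altW, Equiv.Perm.mul_apply, st_swap, ih t s u p ht hs h2 h1]
    by_cases h : Even n
    · simp only [h, Nat.even_add_one, if_true, not_true_eq_false, if_false]
      rw [st_swap, sig_st M v s t k _ _ hs h1, rec2]
    · simp only [h, Nat.even_add_one, not_false_eq_true, if_true, if_false]
      rw [st_swap, sig_st M v s t k _ _ hs h1, rec2]

lemma braid {V : Type} (M : V → V → ℕ) (hsym : ∀ a b : V, M a b = M b a) (s t : V)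
    (hst : 2 ≤ M s t) :
    altW (sig M s) (sig M t) (M s t) = altW (sig M t) (sig M s) (M s t) := by
  by_cases hne : s = t
  · rw [hne]
  ext1 f
  set c := Real.cos (Real.pi / M s t) with hc
  have h1 : bil M s t = -(20 * c) := bil_ne M hne
  have h2 : bil M t s = -(20 * c) := by rw [bil_ne M (Ne.symm hne), hsym t s]
  have hc1 : c ≤ 1 := Real.cos_le_one _
  have hc2 : -1 ≤ c := Real.neg_one_le_cos _
  have hD : (101 ^ 2 - (20 * c) ^ 2) ≠ 0 := by nlinarith
  set D := (101 ^ 2 - (20 * c) ^ 2) with hDdef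
  set p := (101 * f s + 20 * c * f t) / D with hp
  set u := (101 * f t + 20 * c * f s) / D with hu
  set v : V → ℝ := fun w => f w - p * bil M s w - u * bil M t w with hv
  have hpD : p * D = 101 * f s + 20 * c * f t := by rw [hp]; field_simp
  have huD : u * D = 101 * f t + 20 * c * f s := by rw [hu]; field_simp
  have hf : f = st M v s t p u := by
    funext w; simp only [st, hv]; ring
  have hvs : v s = 0 := by
    simp only [hv, bil_self, h2]
    apply mul_right_cancel₀ hD
    linear_combination -101 * hpD + 20 * c * huD + f s * hDdef
  have hvt : v t = 0 := by
    simp only [hv, bil_self, h1]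
    apply mul_right_cancel₀ hD
    linear_combination -101 * huD + 20 * c * hpD + f t * hDdef
  clear_value p u v
  subst hf
  rw [word_st M v (20 * c) _ s t p u hvs hvt h2 h1, st_swap M v s t p u,
    word_st M v (20 * c) _ t s u p hvt hvs h1 h2]
  obtain ⟨a1, a2⟩ := rec2_period _ hst p u
  obtain ⟨a3, a4⟩ := rec2_period _ hst u p
  rw [← hc] at a1 a2 a3 a4
  rw [a1, a2, a3, a4]
  by_cases h : Even (M s t)
  · simp only [h, if_true]; rw [st_swap]
  · simp only [h, if_false]; rw [st_swap]

/-- Homomorphisms out of an Artin group. -/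
lemma exists_hom {V : Type} (M : V → V → ℕ) {G : Type} [Group G] (f : V → G)
    (h : ∀ s t, 2 ≤ M s t → altW (f s) (f t) (M s t) = altW (f t) (f s) (M s t)) :
    ∃ φ : ArtinGroup V M →* G, ∀ s, φ (PresentedGroup.of s) = f s := by
  refine ⟨PresentedGroup.toGroup (f := f) ?_, fun s => PresentedGroup.toGroup.of _⟩
  rintro r ⟨s, t, hst, rfl⟩
  rw [map_mul, map_inv, artinWord_eq, artinWord_eq, map_altW, map_altW]
  simp only [FreeGroup.lift_apply_of]
  rw [h s t hst, mul_inv_cancel]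

lemma altW_rel {V : Type} (M : V → V → ℕ) (s t : V) (hst : 2 ≤ M s t) :
    altW (PresentedGroup.of s : ArtinGroup V M) (PresentedGroup.of t) (M s t) =
      altW (PresentedGroup.of t) (PresentedGroup.of s) (M s t) := by
  have h : PresentedGroup.mk {r : FreeGroup V | ∃ x y : V, 2 ≤ M x y ∧
      r = artinWord x y (M x y) * (artinWord y x (M x y))⁻¹}
      (artinWord s t (M s t) * (artinWord t s (M s t))⁻¹) = 1 :=
    (QuotientGroup.eq_one_iff _).2 (Subgroup.subset_normalClosure ⟨s, t, hst, rfl⟩)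
  rw [map_mul, map_inv, mul_inv_eq_one, artinWord_eq, artinWord_eq, map_altW, map_altW] at h
  exact h

lemma zpow_scale {E : Type*} (g : Equiv.Perm E) (φ : E → ℝ) (c : ℝ) (hc : c ≠ 0)
    (h : ∀ f, φ (g f) = c * φ f) (n : ℤ) (f : E) : φ ((g ^ n) f) = c ^ n * φ f := by
  have hinv : ∀ f, φ (g⁻¹ f) = c⁻¹ * φ f := by
    intro f
    have := h (g⁻¹ f)
    rw [show g (g⁻¹ f) = f from g.apply_symm_apply f] at this
    rw [this]; field_simp
  induction n using Int.induction_on with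
  | zero => simp
  | succ n ih =>
    rw [add_comm, zpow_add, zpow_one, Equiv.Perm.mul_apply, h, ih, zpow_add₀ hc, zpow_one]; ring
  | pred n ih =>
    rw [sub_eq_neg_add, zpow_add, zpow_neg_one, Equiv.Perm.mul_apply, hinv, ih, zpow_add₀ hc,
      zpow_neg_one]; ring

lemma ping_pong {G α : Type} [Group G] [MulAction G α] (a : Fin 2 → G) (X : Fin 2 → Set α)
    (hne : ∀ i, (X i).Nonempty) (hdis : ∀ v, v ∈ X 0 → v ∈ X 1 → False)
    (hpp : ∀ i j, i ≠ j → ∀ n : ℤ, n ≠ 0 → ∀ v ∈ X j, (a i ^ n) • v ∈ X i) :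
    Function.Injective (FreeGroup.lift a) := by
  have : FreeGroup.lift a =
      (Monoid.CoprodI.lift fun i => FreeGroup.lift fun _ => a i).comp
        (@freeGroupEquivCoprodI (Fin 2)).toMonoidHom := by
    ext i
    simp
  rw [this, MonoidHom.coe_comp]
  clear this
  refine Function.Injective.comp ?_ (MulEquiv.injective freeGroupEquivCoprodI)
  change Function.Injective (Monoid.CoprodI.lift fun i : Fin 2 => FreeGroup.lift fun _ => a i)
  let H : Fin 2 → Type := fun _i => FreeGroup Unit
  let f : ∀ i, H i →* G := fun i => FreeGroup.lift fun _ => a i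
  apply Monoid.CoprodI.lift_injective_of_ping_pong f _ X hne
  · intro i j hij
    refine Set.disjoint_left.2 ?_
    intro v hi hj
    fin_cases i <;> fin_cases j <;> simp at hij
    · exact hdis v hi hj
    · exact hdis v hj hi
  · rintro i j hij
    change ∀ h : H i, _
    refine FreeGroup.freeGroupUnitEquivInt.forall_congr_left.mpr ?_
    intro n hne1
    have hnne0 : n ≠ 0 := by
      rintro rfl
      apply hne1
      simp [H, FreeGroup.freeGroupUnitEquivInt]
    rintro _ ⟨v, hv, rfl⟩
    change FreeGroup.lift (fun _ => a i) (FreeGroup.of () ^ n) • v ∈ X i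
    simp only [map_zpow, FreeGroup.lift_apply_of]
    exact hpp i j hij n hnne0 v hv
  · right
    refine ⟨0, ?_⟩
    have h3 : Infinite (FreeGroup Unit) := inferInstance
    exact le_trans (Cardinal.natCast_le_aleph0 (n := 3)) (Cardinal.aleph0_le_mk (FreeGroup Unit))

/-- The ping-pong cone. -/
def Cone (d p u : ℝ) : Prop := |p| < d / 2 * |u| ∨ |u + d * p| < d / 2 * |p|

lemma cone_disj (d p u : ℝ) (hd0 : 0 < d) (hd1 : d ≤ 1 / 2) (h1 : Cone d p u)
    (h2 : Cone d u p) : False := by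
  have ep : |p| ≤ |p + d * u| + d * |u| := by
    have := abs_sub (p + d * u) (d * u)
    rwa [add_sub_cancel_right, abs_mul, abs_of_pos hd0] at this
  have eu : |u| ≤ |u + d * p| + d * |p| := by
    have := abs_sub (u + d * p) (d * p)
    rwa [add_sub_cancel_right, abs_mul, abs_of_pos hd0] at this
  have ep' : d * |u| ≤ |p + d * u| + |p| := by
    have := abs_sub (p + d * u) p
    rwa [add_sub_cancel_left, abs_mul, abs_of_pos hd0] at this
  have eu' : d * |p| ≤ |u + d * p| + |u| := by
    have := abs_sub (u + d * p) u
    rwa [add_sub_cancel_left, abs_mul, abs_of_pos hd0] at this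
  have hp := abs_nonneg p
  have hu := abs_nonneg u
  rcases h1 with h1 | h1 <;> rcases h2 with h2 | h2
  · nlinarith
  · nlinarith
  · nlinarith
  · nlinarith

lemma cone_map (d p u p' u' Q : ℝ) (hd0 : 1 / 11 ≤ d) (hd1 : d ≤ 1 / 2)
    (h1 : ¬ Cone d p u) (hne : p ≠ 0 ∨ u ≠ 0) (hp : p' = Q * p) (hw : u' + d * p' = u + d * p)
    (hQ : 10000 ≤ Q ∨ (0 < Q ∧ Q * 10000 ≤ 1)) : Cone d p' u' := by
  simp only [Cone, not_or, not_lt] at h1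
  obtain ⟨ha, hb⟩ := h1
  have hp0 : 0 < |p| := by
    rw [abs_pos]
    rintro rfl
    simp at ha
    rcases hne with h | h
    · exact h rfl
    · have := abs_pos.2 h
      nlinarith
  have hdpos : 0 < d := by linarith
  have hpa : |p'| = |Q| * |p| := by rw [hp, abs_mul]
  rcases hQ with hQ | ⟨hQ0, hQ⟩
  · right
    rw [hw, hpa, abs_of_pos (show 0 < Q by linarith)]
    have e : |u + d * p| ≤ |u| + d * |p| := by
      have := abs_add_le u (d * p)
      rwa [abs_mul, abs_of_pos hdpos] at this
    have hu : |u| ≤ 22 * |p| := by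
      have := abs_nonneg u
      nlinarith
    have hQp : 10000 * |p| ≤ Q * |p| := by nlinarith
    nlinarith
  · left
    rw [hpa, abs_of_pos hQ0]
    have e : |u + d * p| ≤ |u'| + d * (Q * |p|) := by
      have := abs_add_le u' (d * p')
      rwa [abs_mul, abs_of_pos hdpos, hw, hpa, abs_of_pos hQ0] at this
    have hQp : Q * |p| * 10000 ≤ |p| := by nlinarith
    have hQp0 : 0 < Q * |p| := by positivity
    have : 1 / 22 * |p| ≤ |u'| + 1 / 2 * (Q * |p|) := by nlinarith
    have : 1 / 23 * |p| ≤ |u'| := by nlinarith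
    nlinarith

lemma zpow_cases (n : ℤ) (hn : n ≠ 0) :
    10000 ≤ (10000 : ℝ) ^ n ∨ (0 < (10000 : ℝ) ^ n ∧ (10000 : ℝ) ^ n * 10000 ≤ 1) := by
  rcases lt_or_gt_of_ne hn with h | h
  · right
    refine ⟨by positivity, ?_⟩
    have : (10000 : ℝ) ^ n ≤ (10000 : ℝ) ^ (-1 : ℤ) :=
      zpow_le_zpow_right₀ (by norm_num) (by omega)
    rw [zpow_neg_one] at this
    linarith
  · left
    have : (10000 : ℝ) ^ (1 : ℤ) ≤ (10000 : ℝ) ^ n :=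
      zpow_le_zpow_right₀ (by norm_num) (by omega)
    rwa [zpow_one] at this

lemma sq_zpow {V : Type} (M : V → V → ℕ) (y z : V) (d : ℝ) (hb : bil M y z = -(101 * d))
    (n : ℤ) (f : V → ℝ) :
    (((sig M y) ^ 2) ^ n) f y = 10000 ^ n * f y ∧
    (((sig M y) ^ 2) ^ n) f z + d * (((sig M y) ^ 2) ^ n) f y = f z + d * f y := by
  constructor
  · refine zpow_scale (sig M y ^ 2) (fun f : V → ℝ => f y) 10000 (by norm_num) ?_ n f
    intro f
    simp only [pow_two, Equiv.Perm.mul_apply, sig_apply, bil_self]; ring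
  · have := zpow_scale (sig M y ^ 2) (fun f => f z + d * f y) 1 (by norm_num) (by
      intro f
      simp only [pow_two, Equiv.Perm.mul_apply, sig_apply, bil_self, hb]; ring) n f
    rwa [one_zpow, one_mul] at this

lemma free_perm {V : Type} (M : V → V → ℕ) (y z : V) (hyz : y ≠ z) (d : ℝ)
    (hb : bil M y z = -(101 * d)) (hb' : bil M z y = -(101 * d))
    (hd0 : 1 / 11 ≤ d) (hd1 : d ≤ 1 / 2) :
    Function.Injective (FreeGroup.lift (![sig M y ^ 2, sig M z ^ 2] : Fin 2 → _)) := by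
  classical
  have hdpos : 0 < d := by linarith
  have nz : ∀ p u, Cone d p u → (p ≠ 0 ∨ u ≠ 0) := by
    intro p u h
    by_contra! hc
    rw [hc.1, hc.2] at h
    simp [Cone] at h
  apply ping_pong _ (![{f : V → ℝ | Cone d (f y) (f z)}, {f : V → ℝ | Cone d (f z) (f y)}])
  · intro i
    fin_cases i
    · refine ⟨fun w => if w = z then 1 else 0, ?_⟩
      simp [Cone, hyz, hdpos]
    · refine ⟨fun w => if w = y then 1 else 0, ?_⟩
      simp [Cone, hyz.symm, hdpos]
  · intro v h1 h2
    exact cone_disj d (v y) (v z) hdpos hd1 h1 h2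
  · intro i j hij n hn v hv
    fin_cases i <;> fin_cases j <;> simp at hij
    · change Cone d (v z) (v y) at hv
      obtain ⟨e1, e2⟩ := sq_zpow M y z d hb n v
      exact cone_map d (v y) (v z) _ _ _ hd0 hd1
        (fun h => cone_disj d _ _ hdpos hd1 h hv) (nz _ _ hv).symm e1 e2 (zpow_cases n hn)
    · change Cone d (v y) (v z) at hv
      obtain ⟨e1, e2⟩ := sq_zpow M z y d hb' n v
      exact cone_map d (v z) (v y) _ _ _ hd0 hd1
        (fun h => cone_disj d _ _ hdpos hd1 h hv) (nz _ _ hv).symm e1 e2 (zpow_cases n hn)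

lemma zpow_one_imp (c : ℝ) (hc : 1 < |c|) (n : ℤ) (h : c ^ n = 1) : n = 0 := by
  have h2 : |c| ^ n = 1 := by rw [← abs_zpow, h, abs_one]
  by_contra hn
  exact hc.ne' ((zpow_eq_one_iff_right₀ (by positivity) hc.ne').1 h2 |> fun h => absurd h hn)

/-- Three pairwise commuting independent elements give a copy of `ℤ³`. -/
lemma z3 {G : Type} [Group G] (a b c : G) (hab : Commute a b) (hac : Commute a c)
    (hbc : Commute b c)
    (h : ∀ i j k : ℤ, a ^ i * b ^ j * c ^ k = 1 → i = 0 ∧ j = 0 ∧ k = 0) :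
    ∃ H : Subgroup G, Nonempty (H ≃* Multiplicative (ℤ × ℤ × ℤ)) := by
  let φ : Multiplicative (ℤ × ℤ × ℤ) →* G :=
    { toFun := fun v => a ^ v.toAdd.1 * b ^ v.toAdd.2.1 * c ^ v.toAdd.2.2
      map_one' := by simp
      map_mul' := by
        intro v w
        simp only [toAdd_mul, Prod.fst_add, Prod.snd_add, zpow_add]
        generalize v.toAdd.1 = i1
        generalize v.toAdd.2.1 = i2
        generalize v.toAdd.2.2 = i3
        generalize w.toAdd.1 = j1
        generalize w.toAdd.2.1 = j2
        generalize w.toAdd.2.2 = j3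
        have e1 := (hab.zpow_zpow j1 i2).eq
        have e2 := (hac.zpow_zpow j1 i3).eq
        have e3 := (hbc.zpow_zpow j2 i3).eq
        calc a ^ i1 * a ^ j1 * (b ^ i2 * b ^ j2) * (c ^ i3 * c ^ j3)
            = a ^ i1 * (a ^ j1 * b ^ i2) * (b ^ j2 * c ^ i3) * c ^ j3 := by group
          _ = a ^ i1 * b ^ i2 * (a ^ j1 * c ^ i3) * b ^ j2 * c ^ j3 := by
              rw [e1, e3]; simp only [mul_assoc]
          _ = _ := by rw [e2]; simp only [mul_assoc] }
  have hinj : Function.Injective φ := by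
    rw [injective_iff_map_eq_one]
    intro v hv
    obtain ⟨h1, h2, h3⟩ := h _ _ _ hv
    exact Multiplicative.toAdd.injective (Prod.ext h1 (Prod.ext h2 h3))
  exact ⟨φ.range, ⟨(MonoidHom.ofInjective hinj).symm⟩⟩

lemma altW_len (n : ℕ) (t : Multiplicative ℤ) : altW t t n = t ^ n := by
  induction n with
  | zero => simp [altW]
  | succ n ih => rw [altW, ih, pow_succ']

end ArtinAux

open ArtinAux in
/-- An Artin group whose connected presentation graph contains a
triangle with labels `(2, 2, m)`, `m ≥ 3`, contains a subgroup isomorphic to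
`ℤ³` and also a non-abelian free subgroup (free of rank 2).  (Consequently it is
not weakly commensurable with the fundamental group of any compact irreducible
3-manifold, since a 3-manifold group containing `ℤ³` is virtually `ℤ³` and hence
contains no non-abelian free subgroup.) -/
theorem artin_triangle_22m (V : Type) (M : V → V → ℕ)
    (hsym : ∀ a b : V, M a b = M b a)
    (hconn : ∀ a b : V, Relation.ReflTransGen (fun u v : V => 2 ≤ M u v) a b)
    (x y z : V) (hxy : x ≠ y) (hxz : x ≠ z) (hyz : y ≠ z)
    (m : ℕ) (hm : 3 ≤ m) (h1 : M x y = 2) (h2 : M x z = 2) (h3 : M y z = m) :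
    (∃ H : Subgroup (ArtinGroup V M), Nonempty (H ≃* Multiplicative (ℤ × ℤ × ℤ))) ∧
    (∃ H : Subgroup (ArtinGroup V M), Nonempty (H ≃* FreeGroup (Fin 2))) := by
  subst h3
  obtain ⟨ρ, hρ⟩ := exists_hom M (sig M) (braid M hsym)
  obtain ⟨ℓ, hℓ⟩ := exists_hom M (fun _ : V => Multiplicative.ofAdd (1 : ℤ)) (fun _ _ _ => rfl)
  have hm' : (3 : ℝ) ≤ M y z := by exact_mod_cast hm
  have hcos : 1 / 2 ≤ Real.cos (Real.pi / M y z) := by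
    rw [← Real.cos_pi_div_three]
    apply Real.cos_le_cos_of_nonneg_of_le_pi
    · have := Real.pi_pos
      positivity
    · linarith [Real.pi_pos]
    · exact div_le_div_of_nonneg_left Real.pi_pos.le (by norm_num) hm'
  have hcos1 := Real.cos_le_one (Real.pi / M y z)
  obtain ⟨d, hd⟩ : ∃ d, d = 20 * Real.cos (Real.pi / M y z) / 101 := ⟨_, rfl⟩
  have hb : bil M y z = -(101 * d) := by rw [bil_ne M hyz, hd]; ring
  have hb' : bil M z y = -(101 * d) := by rw [bil_ne M hyz.symm, hsym z y, hd]; ring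
  have hd0 : 1 / 11 ≤ d := by rw [hd]; linarith
  have hd1 : d ≤ 1 / 2 := by rw [hd]; linarith
  have hyx0 : bil M y x = 0 := by
    rw [bil_ne M hxy.symm, hsym y x, h1]; simp
  have hzx0 : bil M z x = 0 := by
    rw [bil_ne M hxz.symm, hsym z x, h2]; simp
  set X : ArtinGroup V M := PresentedGroup.of x with hX
  set Y : ArtinGroup V M := PresentedGroup.of y with hY
  set Z : ArtinGroup V M := PresentedGroup.of z with hZ
  constructor
  · have cxy : Commute X Y := by
      have := altW_rel M x y (by omega)
      rw [h1] at this
      simp only [altW, mul_one] at this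
      exact this
    have cxz : Commute X Z := by
      have := altW_rel M x z (by omega)
      rw [h2] at this
      simp only [altW, mul_one] at this
      exact this
    have hr := altW_rel M y z (by omega)
    set D := altW Y Z (M y z) with hD
    have cyc : Commute Y (D * D) := delta_comm Y Z _ hr
    have czc : Commute Z (D * D) := by
      have := delta_comm Z Y _ hr.symm
      rwa [← hr] at this
    have cxD : Commute X D := by
      have : D ∈ Submonoid.centralizer {X} := altW_mem _ _ _ _
        (Submonoid.mem_centralizer_iff.2 (by rintro _ rfl; exact cxy))
        (Submonoid.mem_centralizer_iff.2 (by rintro _ rfl; exact cxz))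
      exact Submonoid.mem_centralizer_iff.1 this X rfl
    have cxc : Commute X (D * D) := cxD.mul_right cxD
    refine z3 X Y (D * D) cxy cxc cyc ?_
    intro i j k h
    -- the exponent of `Y` vanishes
    have hj : j = 0 := by
      have e : Y ^ j = (X ^ i)⁻¹ * ((D * D) ^ k)⁻¹ := by
        have : Y ^ j * (D * D) ^ k = (X ^ i)⁻¹ := by
          rw [eq_inv_iff_mul_eq_one, ← h]
          exact ((cxy.symm.zpow_zpow j i).mul_left (cxc.symm.zpow_zpow k i)).eq.trans
            (mul_assoc _ _ _).symm
        rw [← this]; group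
      have cz : Commute (Y ^ j) Z := by
        rw [e]
        exact (cxz.zpow_left i).inv_left.mul_left (czc.symm.zpow_left k).inv_left
      have cz2 : Commute (((sig M y) ^ 2) ^ j) (sig M z) := by
        have := (cz.pow_left 2).map ρ
        rw [map_pow, map_zpow, hρ, hρ] at this
        rwa [← zpow_natCast, zpow_comm, zpow_natCast] at this
      classical
      have e1 := congrArg (fun g : Equiv.Perm (V → ℝ) => g (fun w => if w = z then 1 else 0) y)
        cz2.eq
      simp only [Equiv.Perm.mul_apply] at e1
      obtain ⟨s1, s2⟩ := sq_zpow M y z d hb j (fun w => if w = z then 1 else 0)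
      rw [(sq_zpow M y z d hb j _).1, sig_apply, sig_apply] at e1
      simp only [hyz, if_false, mul_zero, add_zero, if_true] at s1 s2
      rw [s1] at s2
      rw [s1] at e1
      simp only [mul_zero, add_zero] at s2
      rw [s2, hb'] at e1
      simp only [hyz, if_false, if_true] at e1
      have : (10000 : ℝ) ^ j = 1 := by
        have hdd : d ≠ 0 := by linarith
        have h101 : (101 * d) ≠ 0 := by positivity
        apply mul_right_cancel₀ h101
        linarith
      exact zpow_one_imp 10000 (by norm_num) j this
    subst hj
    rw [zpow_zero, mul_one] at h
    have hi : i = 0 := by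
      have hfix : ρ (D * D) ∈ {g : Equiv.Perm (V → ℝ) | ∀ f, g f x = f x} := by
        let S : Submonoid (Equiv.Perm (V → ℝ)) :=
          { carrier := {g | ∀ f, g f x = f x}
            one_mem' := fun f => rfl
            mul_mem' := by
              intro g g' hg hg' f
              rw [Equiv.Perm.mul_apply, hg, hg'] }
        have hDm : ρ D ∈ S := by
          rw [hD, map_altW]
          apply altW_mem
          · intro f
            rw [hρ, sig_apply, hyx0, mul_zero, sub_zero]
          · intro f
            rw [hρ, sig_apply, hzx0, mul_zero, sub_zero]
        rw [map_mul]
        exact S.mul_mem hDm hDm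
      have e := congrArg ρ h
      rw [map_mul, map_zpow, map_zpow, hρ, map_one] at e
      have e1 := congrArg (fun g : Equiv.Perm (V → ℝ) => g (fun _ => 1) x) e
      simp only [Equiv.Perm.mul_apply, Equiv.Perm.one_apply] at e1
      have t1 := zpow_scale (sig M x) (fun f => f x) (-100) (by norm_num) (by
        intro f
        simp only [sig_apply, bil_self]; ring) i
      have t2 := zpow_scale (ρ (D * D)) (fun f => f x) 1 (by norm_num) (by
        intro f
        rw [one_mul]; exact hfix f) k
      simp only [one_zpow, one_mul] at t1 t2
      rw [t1, t2, mul_one] at e1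
      exact zpow_one_imp (-100) (by norm_num) i e1
    subst hi
    rw [zpow_zero, one_mul] at h
    refine ⟨rfl, rfl, ?_⟩
    have e := congrArg ℓ h
    rw [map_zpow, map_mul, hD, map_altW, hℓ, hℓ, altW_len, map_one ℓ] at e
    have e2 := congrArg Multiplicative.toAdd e
    simp at e2
    omega
  · have hinj : Function.Injective (FreeGroup.lift (![Y ^ 2, Z ^ 2] : Fin 2 → ArtinGroup V M)) := by
      have hf := free_perm M y z hyz d hb hb' hd0 hd1
      have : FreeGroup.lift (![sig M y ^ 2, sig M z ^ 2] : Fin 2 → _) =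
          ρ.comp (FreeGroup.lift (![Y ^ 2, Z ^ 2] : Fin 2 → ArtinGroup V M)) := by
        ext i : 1
        fin_cases i <;> simp [hρ, hY, hZ]
      rw [this, MonoidHom.coe_comp] at hf
      exact hf.of_comp
    exact ⟨_, ⟨(MonoidHom.ofInjective hinj).symm⟩⟩
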